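/- arXiv:1212.1422 — 2 statements merged into one kernel-verified Lean document; each statement's English description precedes it below -/
import Mathlib

section
/- Weighted Poincaré-type inequality (Lemma 2.1). For k ≥ 3, let f ∈ H^k(Ω) ∩ H₀¹(Ω), f: Ω → ℝ₊ be strictly positive in the interior of Ω, where Ω = B(0,1) is the unit disk in ℝ². Then there exists a universal constant C* such that ‖f‖²_{L²(Ω)} ≤ C* (∫_Ω f(x) φ₁(x) dx) ‖f‖_{H³(Ω)}. -/
noncomputable section
open MeasureTheory Set

/-- Points of the plane. -/
abbrev Pt : Type := EuclideanSpace ℝ (Fin 2)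

/-- The open unit disk `Ω = B(0,1) ⊂ ℝ²`. -/
def disk : Set Pt := Metric.ball 0 1

/-- The boundary circle `Γ = 𝕊¹`. -/
def circ : Set Pt := Metric.sphere 0 1

/-- Standard basis vectors. -/
def basis2 (i : Fin 2) : Pt := EuclideanSpace.single i 1

/-- The Laplacian of a function on the plane. -/
def lap (f : Pt → ℝ) : Pt → ℝ :=
  fun x => ∑ i : Fin 2, fderiv ℝ (fun y => fderiv ℝ f y (basis2 i)) x (basis2 i)

/-- Partial derivative in the `i`-th coordinate direction. -/
def pdX (i : Fin 2) (f : Pt → ℝ) : Pt → ℝ := fun x => fderiv ℝ f x (basis2 i)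

/-- The (integer-order) `H^k(Ω)` Sobolev norm on the unit disk. -/
def sobN (k : ℕ) (f : Pt → ℝ) : ℝ :=
  Real.sqrt (∑ a ∈ Finset.range (k+1), ∑ b ∈ Finset.range (k+1),
    if a + b ≤ k then ∫ x in disk, ((pdX 0)^[a] ((pdX 1)^[b] f) x)^2 else 0)

theorem second_test (u u' : ℝ → ℝ) (a : ℝ) (h1 : ∀ t, HasDerivAt u (u' t) t)
    (h2 : HasDerivAt u' a 0) (hm : IsLocalMin u 0) : 0 ≤ a := by
  by_contra! ha
  have hd : deriv u = u' := funext fun t => (h1 t).deriv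
  have h0 : u' 0 = 0 := by rw [← hd]; exact hm.deriv_eq_zero
  have hM : IsLocalMax u 0 := by
    apply isLocalMax_of_deriv_deriv_neg
    · rw [hd, h2.deriv]; exact ha
    · rw [hd, h0]
    · exact (h1 0).continuousAt
  have hc : u =ᶠ[nhds 0] fun _ => u 0 := by
    filter_upwards [hm, hM] with x hx hy using le_antisymm hy hx
  have hc2 : deriv u =ᶠ[nhds 0] deriv (fun _ => u 0) := hc.deriv
  rw [hd] at hc2
  have : a = 0 := by
    rw [← h2.deriv, hc2.deriv_eq]; simp
  linarith

def hb (x : Pt) : ℝ := (1 - ‖x‖^2) + (1 - ‖x‖^2)^2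

theorem nsq (x : Pt) : ‖x‖^2 = x 0 ^2 + x 1 ^2 := by
  rw [EuclideanSpace.norm_sq_eq]; simp

theorem line_deriv (f : Pt → ℝ) (hf : ContDiff ℝ 1 f) (y v : Pt) (t : ℝ) :
    HasDerivAt (fun t : ℝ => f (y + t • v)) (fderiv ℝ f (y + t • v) v) t := by
  have h1 : HasDerivAt (fun t : ℝ => y + t • v) v t := by
    simpa using ((hasDerivAt_id t).smul_const v).const_add y
  exact ((hf.differentiable (by norm_num)) _).hasFDerivAt.comp_hasDerivAt t h1

theorem D_contDiff (f : Pt → ℝ) (v : Pt) (n : ℕ) (hf : ContDiff ℝ (n+1 : ℕ) f) :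
    ContDiff ℝ n (fun x => fderiv ℝ f x v) :=
  (hf.fderiv_right (by norm_cast)).clm_apply contDiff_const

theorem hopf (φ₁ : Pt → ℝ) (lam1 : ℝ)
    (hsmooth : ContDiff ℝ (⊤ : ℕ∞) φ₁)
    (hlam : 0 < lam1)
    (hpos : ∀ x ∈ disk, 0 < φ₁ x)
    (hbdry : ∀ x ∈ circ, φ₁ x = 0)
    (heigen : ∀ x ∈ disk, lap φ₁ x = -lam1 * φ₁ x) :
    ∃ c > 0, ∀ x ∈ disk, c * (1 - ‖x‖) ≤ φ₁ x := by
  have hcont : Continuous φ₁ := hsmooth.continuous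
  obtain ⟨m, hm0, hm⟩ : ∃ m > 0, ∀ x : Pt, ‖x‖^2 ≤ 3/4 → m ≤ φ₁ x := by
    have hK : IsCompact (Metric.closedBall (0:Pt) 1 ∩ {x : Pt | ‖x‖^2 ≤ 3/4}) :=
      (isCompact_closedBall _ _).inter_right (isClosed_le (by fun_prop) continuous_const)
    obtain ⟨x0, hx0, hmin⟩ := hK.exists_isMinOn ⟨0, by norm_num⟩ hcont.continuousOn
    refine ⟨φ₁ x0, hpos _ ?_, fun x hx => hmin ⟨?_, hx⟩⟩
    · have := hx0.2
      simp only [disk, Metric.mem_ball, dist_zero_right]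
      simp only [mem_ofPred_eq] at this
      nlinarith [norm_nonneg x0]
    · simp only [Metric.mem_closedBall, dist_zero_right]
      nlinarith [norm_nonneg x]
  have hbcont : Continuous hb := by unfold hb; fun_prop
  have key : ∀ x ∈ Metric.closedBall (0:Pt) 1, 0 ≤ φ₁ x - m/2 * hb x := by
    obtain ⟨x0, hx0, hmin⟩ := (isCompact_closedBall (0:Pt) 1).exists_isMinOn ⟨0, by simp⟩
      (f := fun x => φ₁ x - m/2 * hb x) (by fun_prop)
    suffices h : 0 ≤ φ₁ x0 - m/2 * hb x0 from fun x hx => h.trans (hmin hx)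
    simp only [Metric.mem_closedBall, dist_zero_right] at hx0
    rcases le_or_gt (‖x0‖^2) (3/4) with h | h
    · have := hm x0 h
      have h2 : hb x0 ≤ 2 := by unfold hb; nlinarith [sq_nonneg ‖x0‖]
      nlinarith
    rcases hx0.eq_or_lt with h1 | h1
    · have := hbdry x0 (by simpa [circ] using h1)
      rw [this]; unfold hb; rw [h1]; norm_num
    exfalso
    have hloc : IsLocalMin (fun x => φ₁ x - m/2 * hb x) x0 :=
      hmin.isLocalMin (Metric.closedBall_mem_nhds_of_mem (by simpa using h1))
    have hi : ∀ i : Fin 2, 0 ≤ fderiv ℝ (fun y => fderiv ℝ φ₁ y (basis2 i)) x0 (basis2 i)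
        - m/2 * (8 * (x0 i)^2 - 2 * (1 + 2 * (1 - ‖x0‖^2))) := by
      intro i
      have hq : ∀ t : ℝ, ‖x0 + t • basis2 i‖^2 = ‖x0‖^2 + 2 * t * x0 i + t^2 := by
        intro t
        rw [nsq, nsq]
        fin_cases i <;> simp [basis2] <;> ring
      have hqd : ∀ t : ℝ, HasDerivAt (fun t : ℝ => 1 - (‖x0‖^2 + 2 * t * x0 i + t^2))
          (-(2 * x0 i + 2 * t)) t := by
        intro t
        have := ((((hasDerivAt_id t).const_mul 2).mul_const (x0 i)).const_add (‖x0‖^2)).add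
          ((hasDerivAt_id t).pow 2)
        refine HasDerivAt.congr_deriv (this.const_sub 1) ?_
        simp
      have hphi := D_contDiff φ₁ (basis2 i) 1 (contDiff_infty.1 hsmooth (1+1))
      refine second_test (fun t => φ₁ (x0 + t • basis2 i) - m/2 * hb (x0 + t • basis2 i))
        (fun t => fderiv ℝ φ₁ (x0 + t • basis2 i) (basis2 i) - m/2 *
          ((1 + 2 * (1 - (‖x0‖^2 + 2 * t * x0 i + t^2))) * (-(2 * x0 i + 2 * t)))) _ ?_ ?_ ?_
      · intro t
        refine (line_deriv φ₁ (hsmooth.of_le (by exact_mod_cast le_top)) x0 _ t).sub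
          (HasDerivAt.const_mul _ ?_)
        simp only [hb, hq]
        refine HasDerivAt.congr_deriv ((hqd t).add ((hqd t).pow 2)) ?_
        simp; ring
      · have h1 := line_deriv _ hphi x0 (basis2 i) 0
        simp only [zero_smul, add_zero] at h1
        refine h1.sub (HasDerivAt.const_mul _ ?_)
        have h2 : HasDerivAt (fun t : ℝ => -(2 * x0 i + 2 * t)) (-2) 0 := by
          have := (((hasDerivAt_id (0:ℝ)).const_mul 2).const_add (2 * x0 i)).neg
          refine HasDerivAt.congr_deriv this ?_
          simp
        refine HasDerivAt.congr_deriv ((((hqd 0).const_mul 2).const_add 1).mul h2) ?_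
        simp; ring
      · have hc : ContinuousAt (fun t : ℝ => x0 + t • basis2 i) 0 := by fun_prop
        have : IsLocalMin (fun x => φ₁ x - m/2 * hb x) (x0 + (0:ℝ) • basis2 i) := by simpa using hloc
        exact hc.eventually this |>.mono fun t ht => by simpa using ht
    have hx0d : x0 ∈ disk := by simpa [disk] using h1
    have h3 := heigen x0 hx0d
    have h4 := hpos x0 hx0d
    have h5 := hi 0
    have h6 := hi 1
    simp only [lap, Fin.sum_univ_two] at h3
    have h7 := nsq x0
    have h8 : 0 < lam1 * φ₁ x0 := mul_pos hlam h4
    nlinarith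
  refine ⟨m/2, by positivity, fun x hx => ?_⟩
  simp only [disk, Metric.mem_ball, dist_zero_right] at hx
  have := key x (by simpa using hx.le)
  have h2 : 1 - ‖x‖ ≤ hb x := by
    unfold hb
    nlinarith [norm_nonneg x, sq_nonneg (1 - ‖x‖^2)]
  nlinarith

theorem repr1 (u u' : ℝ → ℝ) (h1 : ∀ t, HasDerivAt u (u' t) t) (hc : Continuous u') :
    u 0 = ∫ t in (0:ℝ)..(1/2), (2 * u t - (1 - 2 * t) * u' t) := by
  have hu : Continuous u := continuous_iff_continuousAt.2 fun t => (h1 t).continuousAt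
  have := intervalIntegral.integral_eq_sub_of_hasDerivAt (a := 0) (b := 1/2)
    (f := fun t => -((1 - 2 * t) * u t)) (f' := fun t => 2 * u t - (1 - 2 * t) * u' t) ?_ ?_
  · rw [this]; norm_num
  · intro t _
    have h2 : HasDerivAt (fun t : ℝ => 1 - 2 * t) (-2) t := by
      simpa using ((hasDerivAt_id t).const_mul 2).const_sub 1
    have h3 := (h2.mul (h1 t)).neg
    refine HasDerivAt.congr_deriv h3 ?_
    ring
  · exact Continuous.intervalIntegrable (by fun_prop) _ _

theorem transfer (y v w : Pt) (hv : ‖v‖ = 1) (hw : ‖w‖ = 1) (hvw : inner ℝ v w = 0)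
    (hmem : ∀ s ∈ Ioc (0:ℝ) (1/2), ∀ t ∈ Ioc (0:ℝ) (1/2), y + t • w + s • v ∈ disk)
    (Q : Pt → ℝ) (hQ : Continuous Q) (hQ0 : ∀ x, 0 ≤ Q x) :
    ∫ t in (0:ℝ)..(1/2), ∫ s in (0:ℝ)..(1/2), Q (y + t • w + s • v) ≤ ∫ x in disk, Q x := by
  have ho : Orthonormal ℝ ![w, v] := by
    rw [orthonormal_iff_ite]
    intro i j
    fin_cases i <;> fin_cases j <;> simp [hv, hw, hvw, real_inner_comm]
  have hspan : ⊤ ≤ Submodule.span ℝ (Set.range ![w, v]) :=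
    (ho.linearIndependent.span_eq_top_of_card_eq_finrank (by simp)).ge
  let b := OrthonormalBasis.mk ho hspan
  let e := (MeasurableEquiv.finTwoArrow (α := ℝ)).symm.trans ((MeasurableEquiv.toLp 2 (Fin 2 → ℝ)).trans b.measurableEquiv.symm)
  have he : MeasurePreserving e := by
    refine MeasurePreserving.trans ?_ (MeasurePreserving.trans (PiLp.volume_preserving_toLp _) (b.measurePreserving_measurableEquiv.symm _))
    exact (volume_preserving_finTwoArrow ℝ).symm _
  have heq : ∀ p : ℝ × ℝ, e p = p.1 • w + p.2 • v := by
    intro p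
    change b.repr.symm _ = _
    rw [← b.sum_repr_symm]
    simp [b, Fin.sum_univ_two, MeasurableEquiv.finTwoArrow, MeasurableEquiv.piFinTwo]
  have he2 : MeasurePreserving (fun p : ℝ × ℝ => y + e p) :=
    (measurePreserving_add_left volume y).comp he
  have hemb : MeasurableEmbedding (fun p : ℝ × ℝ => y + e p) :=
    (MeasurableEquiv.addLeft y).measurableEmbedding.comp e.measurableEmbedding
  have hI : IntegrableOn Q disk := (hQ.continuousOn.integrableOn_compact (isCompact_closedBall 0 1)).mono_set Metric.ball_subset_closedBall
  have hQ2 : Continuous (fun p : ℝ × ℝ => Q (y + p.1 • w + p.2 • v)) := by fun_prop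
  have hE : ∀ p : ℝ × ℝ, y + e p = y + p.1 • w + p.2 • v := fun p => by rw [heq, add_assoc]
  have h1 : ∫ x in disk, Q x = ∫ p in (fun p : ℝ × ℝ => y + e p) ⁻¹' disk, Q (y + p.1 • w + p.2 • v) := by
    rw [← he2.setIntegral_preimage_emb hemb]
    simp only [hE]
  have hI2 : IntegrableOn (fun p : ℝ × ℝ => Q (y + p.1 • w + p.2 • v)) ((fun p : ℝ × ℝ => y + e p) ⁻¹' disk) := by
    have := (he2.integrableOn_comp_preimage hemb).2 hI
    simpa only [Function.comp_def, hE] using this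
  have h2 : ∫ t in (0:ℝ)..(1/2), ∫ s in (0:ℝ)..(1/2), Q (y + t • w + s • v)
      = ∫ p in Ioc (0:ℝ) (1/2) ×ˢ Ioc (0:ℝ) (1/2), Q (y + p.1 • w + p.2 • v) := by
    rw [Measure.volume_eq_prod, setIntegral_prod]
    · simp only [intervalIntegral.integral_of_le (show (0:ℝ) ≤ 1/2 by norm_num)]
    · rw [← Measure.volume_eq_prod]
      exact (hQ2.continuousOn.integrableOn_compact (isCompact_Icc.prod isCompact_Icc)).mono_set
        (Set.prod_mono Ioc_subset_Icc_self Ioc_subset_Icc_self)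
  rw [h1, h2]
  refine setIntegral_mono_set hI2 (Filter.Eventually.of_forall fun p => hQ0 _) (Filter.Eventually.of_forall ?_)
  intro p hp
  have := hmem p.2 hp.2 p.1 hp.1
  change y + e p ∈ disk
  rwa [hE]

theorem D_comm (f : Pt → ℝ) (hf : ContDiff ℝ 2 f) (v w : Pt) :
    (fun x => fderiv ℝ (fun y => fderiv ℝ f y v) x w) = (fun x => fderiv ℝ (fun y => fderiv ℝ f y w) x v) := by
  have hd : Differentiable ℝ (fderiv ℝ f) := (hf.fderiv_right (m := 1) (by norm_num)).differentiable (by norm_num)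
  have h : ∀ x v w, fderiv ℝ (fun y => fderiv ℝ f y v) x w = fderiv ℝ (fderiv ℝ f) x w v := by
    intro x v w
    rw [fderiv_clm_apply (hd x) (by fun_prop)]
    simp
  funext x
  rw [h, h]
  exact (hf.contDiffAt.isSymmSndFDerivAt (by simp)).eq w v

theorem D_bound (f : Pt → ℝ) (v : Pt) (h0 : |v 0| ≤ 1) (h1 : |v 1| ≤ 1) (x : Pt) :
    |fderiv ℝ f x v| ≤ |pdX 0 f x| + |pdX 1 f x| := by
  have : v = v 0 • basis2 0 + v 1 • basis2 1 := by
    ext i; fin_cases i <;> simp [basis2]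
  have h : fderiv ℝ f x v = v 0 * pdX 0 f x + v 1 * pdX 1 f x := by
    conv_lhs => rw [this]
    simp [pdX]
  rw [h]
  refine (abs_add_le _ _).trans ?_
  rw [abs_mul, abs_mul]
  nlinarith [abs_nonneg (pdX 0 f x), abs_nonneg (pdX 1 f x)]

set_option maxHeartbeats 2000000 in
theorem key (f : Pt → ℝ) (hf : ContDiff ℝ (3:ℕ) f) (c d : ℝ) (hcd : c^2 + d^2 = 1)
    (r : ℝ) (hr0 : 0 ≤ r) (hr1 : r ≤ 1) (N : ℝ) (hN : 0 < N) (S : Pt → ℝ) (hS : Continuous S)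
    (hS0 : ∀ x, 0 ≤ S x) (hSI : ∫ x in disk, S x = N^2)
    (h1 : ∀ i x, |pdX i f x| ≤ √(S x))
    (h2 : ∀ i j x, |pdX i (pdX j f) x| ≤ √(S x))
    (h3 : ∀ i j k x, |pdX i (pdX j (pdX k f)) x| ≤ √(S x)) :
    |fderiv ℝ f (r • !₂[c, d]) !₂[c, d]| ≤ 16 * (1 + volume.real disk) * N := by
  have hc1 : |c| ≤ 1 := abs_le_one_iff_mul_self_le_one.2 (by nlinarith [sq_nonneg d])
  have hd1 : |d| ≤ 1 := abs_le_one_iff_mul_self_le_one.2 (by nlinarith [sq_nonneg c])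
  set e : Pt := !₂[c, d] with he
  obtain ⟨v, hvdef⟩ : ∃ v : Pt, v = !₂[-(3/5)*c - (4/5)*d, -(3/5)*d + (4/5)*c] := ⟨_, rfl⟩
  obtain ⟨w, hwdef⟩ : ∃ w : Pt, w = !₂[-(4/5)*c + (3/5)*d, -(4/5)*d - (3/5)*c] := ⟨_, rfl⟩
  have hv0 : v 0 = -(3/5)*c - (4/5)*d := by simp [hvdef]
  have hv1 : v 1 = -(3/5)*d + (4/5)*c := by simp [hvdef]
  have hw0 : w 0 = -(4/5)*c + (3/5)*d := by simp [hwdef]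
  have hw1 : w 1 = -(4/5)*d - (3/5)*c := by simp [hwdef]
  have hv2 : v 0 ^2 + v 1 ^2 = 1 := by rw [hv0, hv1]; linear_combination hcd
  have hw2 : w 0 ^2 + w 1 ^2 = 1 := by rw [hw0, hw1]; linear_combination hcd
  have bd : ∀ z : Pt, z 0 ^2 + z 1 ^2 = 1 → |z 0| ≤ 1 ∧ |z 1| ≤ 1 := fun z hz =>
    ⟨abs_le_one_iff_mul_self_le_one.2 (by nlinarith [sq_nonneg (z 1)]),
     abs_le_one_iff_mul_self_le_one.2 (by nlinarith [sq_nonneg (z 0)])⟩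
  have hv : ‖v‖ = 1 := by
    have := nsq v; rw [hv2] at this
    nlinarith [norm_nonneg v]
  have hw : ‖w‖ = 1 := by
    have := nsq w; rw [hw2] at this
    nlinarith [norm_nonneg w]
  have hvw : inner ℝ v w = 0 := by
    simp only [PiLp.inner_apply, Fin.sum_univ_two, hv0, hv1, hw0, hw1]
    simp; ring
  set y : Pt := r • e with hy
  have hmem : ∀ s ∈ Ioc (0:ℝ) (1/2), ∀ t ∈ Ioc (0:ℝ) (1/2), y + t • w + s • v ∈ disk := by
    intro s hs t ht
    have hn : ‖y + t • w + s • v‖^2 = r^2 + s^2 + t^2 - 2 * r * (3 * s + 4 * t)/5 := by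
      rw [nsq]
      simp only [PiLp.add_apply, PiLp.smul_apply, smul_eq_mul, hv0, hv1, hw0, hw1, hy, he]
      simp
      linear_combination (r^2 + s^2 + t^2 - 2 * r * (3 * s + 4 * t)/5) * hcd
    have h : ‖y + t • w + s • v‖^2 < 1 := by
      rw [hn]
      have e1 := hs.1
      have e2 := hs.2
      have e3 := ht.1
      have e4 := ht.2
      have q1 : r^2 ≤ r := by nlinarith only [hr0, hr1]
      have q2 : s^2 ≤ s/2 := by nlinarith only [e1, e2]
      have q3 : t^2 ≤ t/2 := by nlinarith only [e3, e4]
      have q4 : 0 < (1 - r) * (1 - (s + t)/2) + r * (7/10 * s + 11/10 * t) := by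
        rcases hr0.eq_or_lt with h | h
        · rw [← h]; linarith only [e2, e4]
        · have : 0 < r * (7/10 * s + 11/10 * t) := by positivity
          have : 0 ≤ (1 - r) * (1 - (s + t)/2) := mul_nonneg (by linarith only [hr1]) (by linarith only [e2, e4])
          linarith
      linarith only [q1, q2, q3, q4]
    simp only [disk, Metric.mem_ball, dist_zero_right]
    nlinarith [norm_nonneg (y + t • w + s • v)]
  -- derivatives
  set g : Pt → ℝ := fun x => fderiv ℝ f x e with hg
  have hgc : ContDiff ℝ (2:ℕ) g := D_contDiff f e 2 hf
  set gw : Pt → ℝ := fun x => fderiv ℝ g x w with hgw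
  have hgwc : ContDiff ℝ (1:ℕ) gw := D_contDiff g w 1 hgc
  set gv : Pt → ℝ := fun x => fderiv ℝ g x v with hgv
  have hgvc : ContDiff ℝ (1:ℕ) gv := D_contDiff g v 1 hgc
  set gwv : Pt → ℝ := fun x => fderiv ℝ gw x v with hgwv
  have hgwvc : Continuous gwv := (D_contDiff gw v 0 hgwc).continuous
  have cg := hgc.continuous
  have cgv := hgvc.continuous
  have cgw := hgwc.continuous
  have pc : ∀ i, ContDiff ℝ (2:ℕ) (pdX i f) := fun i => D_contDiff f (basis2 i) 2 hf
  have ppc : ∀ i j, ContDiff ℝ (1:ℕ) (pdX i (pdX j f)) := fun i j => D_contDiff _ (basis2 i) 1 (pc j)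
  have he' : |e 0| ≤ 1 ∧ |e 1| ≤ 1 := ⟨by simpa [he] using hc1, by simpa [he] using hd1⟩
  -- commutation
  have k1 : ∀ i, pdX i g = fun x => fderiv ℝ (pdX i f) x e := fun i =>
    D_comm f (hf.of_le (by norm_num)) e (basis2 i)
  have k2 : ∀ i j, pdX i (pdX j g) = fun x => fderiv ℝ (pdX i (pdX j f)) x e := fun i j => by
    rw [k1]; exact D_comm (pdX j f) (pc j) e (basis2 i)
  have k3 : ∀ i, pdX i gw = fun x => fderiv ℝ (pdX i g) x w := fun i =>
    D_comm g hgc w (basis2 i)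
  have b1 : ∀ x, |g x| ≤ 2 * √(S x) := fun x => by
    have := D_bound f e he'.1 he'.2 x
    linarith [h1 0 x, h1 1 x]
  have b2 : ∀ i x, |pdX i g x| ≤ 2 * √(S x) := fun i x => by
    rw [k1]
    have := D_bound (pdX i f) e he'.1 he'.2 x
    linarith [h2 0 i x, h2 1 i x]
  have b3 : ∀ i j x, |pdX i (pdX j g) x| ≤ 2 * √(S x) := fun i j x => by
    rw [k2]
    have := D_bound (pdX i (pdX j f)) e he'.1 he'.2 x
    linarith [h3 0 i j x, h3 1 i j x]
  have b4 : ∀ x, |gv x| ≤ 4 * √(S x) := fun x => by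
    have := D_bound g v (bd v hv2).1 (bd v hv2).2 x
    linarith [b2 0 x, b2 1 x]
  have b5 : ∀ x, |gw x| ≤ 4 * √(S x) := fun x => by
    have := D_bound g w (bd w hw2).1 (bd w hw2).2 x
    linarith [b2 0 x, b2 1 x]
  have b6 : ∀ i x, |pdX i gw x| ≤ 4 * √(S x) := fun i x => by
    rw [k3]
    have := D_bound (pdX i g) w (bd w hw2).1 (bd w hw2).2 x
    linarith [b3 0 i x, b3 1 i x]
  have b7 : ∀ x, |gwv x| ≤ 8 * √(S x) := fun x => by
    have := D_bound gw v (bd v hv2).1 (bd v hv2).2 x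
    linarith [b6 0 x, b6 1 x]
  -- representation
  have r0 : ∀ t : ℝ, g (y + t • w) = ∫ s in (0:ℝ)..(1/2),
      (2 * g (y + t • w + s • v) - (1 - 2 * s) * gv (y + t • w + s • v)) := fun t => by
    have := repr1 (fun s => g (y + t • w + s • v)) (fun s => gv (y + t • w + s • v))
      (fun s => line_deriv g (hgc.of_le (by norm_num)) _ _ _) (by fun_prop)
    simpa using this
  have r1 : ∀ t : ℝ, gw (y + t • w) = ∫ s in (0:ℝ)..(1/2),
      (2 * gw (y + t • w + s • v) - (1 - 2 * s) * gwv (y + t • w + s • v)) := fun t => by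
    have := repr1 (fun s => gw (y + t • w + s • v)) (fun s => gwv (y + t • w + s • v))
      (fun s => line_deriv gw hgwc _ _ _) (by fun_prop)
    simpa using this
  have r2 : g y = ∫ t in (0:ℝ)..(1/2), (2 * g (y + t • w) - (1 - 2 * t) * gw (y + t • w)) := by
    have := repr1 (fun t => g (y + t • w)) (fun t => gw (y + t • w))
      (fun s => line_deriv g (hgc.of_le (by norm_num)) _ _ _) (by fun_prop)
    simpa using this
  let Q : Pt → ℝ := fun x => 16 * (S x / N + N)
  have hQc : Continuous Q := by fun_prop
  have hSQ : ∀ x, 32 * √(S x) ≤ Q x := fun x => by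
    have hs := Real.sq_sqrt (hS0 x)
    have : Q x = 16 * (√(S x)^2 / N + N) := by rw [hs]
    rw [this]
    have : √(S x)^2 / N + N - 2 * √(S x) = (√(S x) - N)^2 / N := by field_simp; ring
    have h4 : 0 ≤ (√(S x) - N)^2 / N := by positivity
    linarith
  have hQ0 : ∀ x, 0 ≤ Q x := fun x => le_trans (by positivity) (hSQ x)
  have inner_bd : ∀ t ∈ Ioc (0:ℝ) (1/2), ‖2 * g (y + t • w) - (1 - 2 * t) * gw (y + t • w)‖
      ≤ ∫ s in (0:ℝ)..(1/2), Q (y + t • w + s • v) := by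
    intro t ht
    rw [r0, r1, ← intervalIntegral.integral_const_mul, ← intervalIntegral.integral_const_mul,
      ← intervalIntegral.integral_sub (Continuous.intervalIntegrable (by fun_prop) _ _)
        (Continuous.intervalIntegrable (by fun_prop) _ _)]
    refine intervalIntegral.norm_integral_le_of_norm_le (by norm_num)
      (Filter.Eventually.of_forall fun s hs => ?_) (Continuous.intervalIntegrable (by fun_prop) _ _)
    refine le_trans ?_ (hSQ _)
    rw [Real.norm_eq_abs]
    generalize y + t • w + s • v = x
    have a1 := b1 x
    have a2 := b4 x
    have a3 := b5 x
    have a4 := b7 x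
    have hs' : |1 - 2 * s| ≤ 1 := abs_le.2 ⟨by linarith [hs.2], by linarith [hs.1]⟩
    have ht' : |1 - 2 * t| ≤ 1 := abs_le.2 ⟨by linarith [ht.2], by linarith [ht.1]⟩
    have m1 : |(1 - 2 * s) * gv x| ≤ 4 * √(S x) := by
      rw [abs_mul]; exact (mul_le_of_le_one_left (abs_nonneg _) hs').trans a2
    have m2 : |(1 - 2 * s) * gwv x| ≤ 8 * √(S x) := by
      rw [abs_mul]; exact (mul_le_of_le_one_left (abs_nonneg _) hs').trans a4
    have m3 : |2 * gw x - (1 - 2 * s) * gwv x| ≤ 16 * √(S x) := by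
      refine (abs_sub _ _).trans ?_
      rw [abs_mul, abs_two]; linarith
    have m4 : |(1 - 2 * t) * (2 * gw x - (1 - 2 * s) * gwv x)| ≤ 16 * √(S x) := by
      rw [abs_mul]; exact (mul_le_of_le_one_left (abs_nonneg _) ht').trans m3
    have m5 : |2 * g x - (1 - 2 * s) * gv x| ≤ 8 * √(S x) := by
      refine (abs_sub _ _).trans ?_
      rw [abs_mul, abs_two]; linarith
    refine (abs_sub _ _).trans ?_
    rw [abs_mul, abs_two]; linarith
  have fin1 : |g y| ≤ ∫ t in (0:ℝ)..(1/2), ∫ s in (0:ℝ)..(1/2), Q (y + t • w + s • v) := by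
    rw [r2, ← Real.norm_eq_abs]
    refine intervalIntegral.norm_integral_le_of_norm_le (by norm_num)
      (Filter.Eventually.of_forall inner_bd) (Continuous.intervalIntegrable ?_ _ _)
    exact intervalIntegral.continuous_parametric_intervalIntegral_of_continuous'
      (by simp only [Function.uncurry_def]; fun_prop) _ _
  refine fin1.trans ((transfer y v w hv hw hvw hmem Q hQc hQ0).trans (le_of_eq ?_))
  have hI : IntegrableOn S disk := (hS.continuousOn.integrableOn_compact
    (isCompact_closedBall 0 1)).mono_set Metric.ball_subset_closedBall
  have hfin : volume disk ≠ ⊤ := Metric.isBounded_ball.measure_lt_top.ne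
  simp only [Q]
  rw [integral_const_mul, integral_add (hI.div_const N) (integrableOn_const hfin), integral_div, hSI,
    setIntegral_const, smul_eq_mul]
  field_simp

def SS (f : Pt → ℝ) (x : Pt) : ℝ :=
  ∑ a ∈ Finset.range 4, ∑ b ∈ Finset.range 4,
    if a + b ≤ 3 then ((pdX 0)^[a] ((pdX 1)^[b] f) x)^2 else 0

theorem iter_contDiff (i : Fin 2) (a : ℕ) : ∀ (n : ℕ) (f : Pt → ℝ), ContDiff ℝ (n + a : ℕ) f →
    ContDiff ℝ n ((pdX i)^[a] f) := by
  induction a with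
  | zero => intro n f hf; simpa using hf
  | succ a ih =>
    intro n f hf
    rw [Function.iterate_succ_apply]
    exact ih n _ (D_contDiff f _ (n + a) hf)

theorem term_cont (f : Pt → ℝ) (hf : ContDiff ℝ (3:ℕ) f) (a b : ℕ) (h : a + b ≤ 3) :
    Continuous ((pdX 0)^[a] ((pdX 1)^[b] f)) := by
  refine (iter_contDiff 0 a 0 _ (iter_contDiff 1 b (0 + a) f (hf.of_le ?_))).continuous
  exact_mod_cast (by omega : 0 + a + b ≤ 3)

theorem SS_cont (f : Pt → ℝ) (hf : ContDiff ℝ (3:ℕ) f) : Continuous (SS f) := by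
  unfold SS
  refine continuous_finsetSum _ fun a _ => continuous_finsetSum _ fun b _ => ?_
  split_ifs with h
  · exact (term_cont f hf a b h).pow 2
  · exact continuous_const

theorem disk_int (S : Pt → ℝ) (hS : Continuous S) : IntegrableOn S disk :=
  (hS.continuousOn.integrableOn_compact
    (isCompact_closedBall 0 1)).mono_set Metric.ball_subset_closedBall

theorem SS_int (f : Pt → ℝ) (hf : ContDiff ℝ (3:ℕ) f) :
    ∫ x in disk, SS f x = ∑ a ∈ Finset.range 4, ∑ b ∈ Finset.range 4,
    if a + b ≤ 3 then ∫ x in disk, ((pdX 0)^[a] ((pdX 1)^[b] f) x)^2 else 0 := by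
  have hc : ∀ a b, Continuous fun x => if a + b ≤ 3 then ((pdX 0)^[a] ((pdX 1)^[b] f) x)^2 else 0 := by
    intro a b
    split_ifs with h
    · exact (term_cont f hf a b h).pow 2
    · exact continuous_const
  unfold SS
  rw [integral_finsetSum _ fun a _ => disk_int _ (continuous_finsetSum _ fun b _ => hc a b)]
  refine Finset.sum_congr rfl fun a _ => ?_
  rw [integral_finsetSum _ fun b _ => disk_int _ (hc a b)]
  refine Finset.sum_congr rfl fun b _ => ?_
  split_ifs <;> simp

theorem SS_term (f : Pt → ℝ) (a b : ℕ) (h : a + b ≤ 3) (x : Pt) :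
    ((pdX 0)^[a] ((pdX 1)^[b] f) x)^2 ≤ SS f x := by
  have h0 : ∀ a b, 0 ≤ if a + b ≤ 3 then ((pdX 0)^[a] ((pdX 1)^[b] f) x)^2 else 0 := by
    intro a b; split_ifs <;> positivity
  unfold SS
  refine le_trans ?_ (Finset.single_le_sum (fun a _ => Finset.sum_nonneg fun b _ => h0 a b)
    (Finset.mem_range.2 (by omega : a < 4)))
  refine le_trans ?_ (Finset.single_le_sum (fun b _ => h0 a b)
    (Finset.mem_range.2 (by omega : b < 4)))
  simp [h]

theorem main_bound (f : Pt → ℝ) (hf : ContDiff ℝ (3:ℕ) f) (hb : ∀ x ∈ circ, f x = 0)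
    (hpos : ∀ x ∈ disk, 0 < f x) (x : Pt) (hx : x ∈ disk) :
    f x ≤ 16 * (1 + volume.real disk) * sobN 3 f * (1 - ‖x‖) := by
  have hS := SS_cont f hf
  have hS0 : ∀ x, 0 ≤ SS f x := fun x => le_trans (sq_nonneg _) (SS_term f 0 0 (by norm_num) x)
  have hNdef : sobN 3 f = √(∫ x in disk, SS f x) := by rw [SS_int f hf]; rfl
  have hdo : IsOpen disk := Metric.isOpen_ball
  have h0d : (0:Pt) ∈ disk := by simp [disk]
  have hIpos : 0 < ∫ x in disk, SS f x := by
    rw [setIntegral_pos_iff_support_of_nonneg_ae (Filter.Eventually.of_forall hS0) (disk_int _ hS)]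
    refine lt_of_lt_of_le (hdo.measure_pos volume ⟨0, h0d⟩) (measure_mono fun z hz => ⟨?_, hz⟩)
    have h1 := SS_term f 0 0 (by norm_num) z
    have h2 := hpos z hz
    simp only [Function.iterate_zero, id] at h1
    have : 0 < SS f z := lt_of_lt_of_le (by positivity) h1
    exact this.ne'
  have hN : 0 < sobN 3 f := by rw [hNdef]; exact Real.sqrt_pos.2 hIpos
  have hSI : ∫ x in disk, SS f x = (sobN 3 f)^2 := by
    rw [hNdef, Real.sq_sqrt hIpos.le]
  have T : ∀ a b, a + b ≤ 3 → ∀ x, |(pdX 0)^[a] ((pdX 1)^[b] f) x| ≤ √(SS f x) := fun a b h x =>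
    Real.abs_le_sqrt (SS_term f a b h x)
  have comm : ∀ g : Pt → ℝ, ContDiff ℝ (2:ℕ) g → pdX 1 (pdX 0 g) = pdX 0 (pdX 1 g) := fun g hg =>
    D_comm g hg (basis2 0) (basis2 1)
  have pc : ∀ i, ContDiff ℝ (2:ℕ) (pdX i f) := fun i => D_contDiff f (basis2 i) 2 hf
  have cf := comm f (hf.of_le (by norm_num))
  have c0 := comm _ (pc 0)
  have c1 := comm _ (pc 1)
  have h1 : ∀ i x, |pdX i f x| ≤ √(SS f x) := by
    intro i x
    fin_cases i
    · exact T 1 0 (by norm_num) x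
    · exact T 0 1 (by norm_num) x
  have h2 : ∀ i j x, |pdX i (pdX j f) x| ≤ √(SS f x) := by
    intro i j x
    have t := T 1 1 (by norm_num) x
    fin_cases i <;> fin_cases j
    · exact T 2 0 (by norm_num) x
    · exact t
    · simp only [Fin.mk_one, Fin.zero_eta, cf]; exact t
    · exact T 0 2 (by norm_num) x
  have h3 : ∀ i j k x, |pdX i (pdX j (pdX k f)) x| ≤ √(SS f x) := by
    intro i j k x
    have t1 := T 2 1 (by norm_num) x
    have t2 := T 1 2 (by norm_num) x
    fin_cases i <;> fin_cases j <;> fin_cases k <;> simp only [Fin.mk_one, Fin.zero_eta]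
    · exact T 3 0 (by norm_num) x
    · exact t1
    · rw [cf]; exact t1
    · exact t2
    · rw [c0, cf]; exact t1
    · rw [c1]; exact t2
    · rw [cf, c1]; exact t2
    · exact T 0 3 (by norm_num) x
  obtain ⟨c, d, hcd, hxe⟩ : ∃ c d : ℝ, c^2 + d^2 = 1 ∧ x = ‖x‖ • !₂[c, d] := by
    by_cases h : x = 0
    · exact ⟨1, 0, by norm_num, by simp [h]⟩
    · have hn : ‖x‖ ≠ 0 := norm_ne_zero_iff.2 h
      refine ⟨x 0 / ‖x‖, x 1 / ‖x‖, ?_, ?_⟩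
      · have := nsq x
        field_simp
        linarith
      · ext i; fin_cases i <;> simp <;> field_simp
  have hx1 : ‖x‖ < 1 := by simpa [disk] using hx
  set e : Pt := !₂[c, d] with he
  have hcirc : f e = 0 := by
    apply hb
    have := nsq e
    simp only [he] at this
    simp [hcd] at this
    have h5 : ‖e‖ = 1 := by
      rcases this with h | h
      · exact h
      · linarith [norm_nonneg e]
    simpa [circ] using h5
  have := (convex_Icc (0:ℝ) 1).norm_image_sub_le_of_norm_hasDerivWithin_le
    (f := fun r : ℝ => f (r • e)) (f' := fun r => fderiv ℝ f (r • e) e)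
    (C := 16 * (1 + volume.real disk) * sobN 3 f) (x := 1) (y := ‖x‖)
    (fun r _ => by
      have := line_deriv f (hf.of_le (by norm_num)) 0 e r
      simp only [zero_add] at this
      exact this.hasDerivWithinAt)
    (fun r hr => key f hf c d hcd r hr.1 hr.2 _ hN (SS f) hS hS0 hSI h1 h2 h3)
    ⟨by norm_num, le_rfl⟩ ⟨norm_nonneg _, hx1.le⟩
  simp only [one_smul, hcirc, sub_zero, ← hxe] at this
  rw [Real.norm_eq_abs, Real.norm_eq_abs, abs_of_nonpos (by linarith : ‖x‖ - 1 ≤ 0)] at this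
  have h6 := le_abs_self (f x)
  linarith

/-- **Lemma 2.1** (weighted Poincaré-type inequality). Let `φ₁` be the first Dirichlet
eigenfunction of `−Δ` on the unit disk (positive, `L²`-normalized, with smallest
eigenvalue `λ₁`). For `k ≥ 3`, every strictly positive `f ∈ H^k(Ω) ∩ H₀¹(Ω)` satisfies
`‖f‖²_{L²(Ω)} ≤ C* (∫_Ω f φ₁) ‖f‖_{H³(Ω)}` for a universal constant `C*`. -/
theorem weighted_poincare_inequality
    (φ₁ : Pt → ℝ) (lam1 : ℝ)
    (hsmooth : ContDiff ℝ (⊤ : ℕ∞) φ₁)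
    (hlam : 0 < lam1)
    (hpos : ∀ x ∈ disk, 0 < φ₁ x)
    (hbdry : ∀ x ∈ circ, φ₁ x = 0)
    (heigen : ∀ x ∈ disk, lap φ₁ x = -lam1 * φ₁ x)
    (hnorm : ∫ x in disk, (φ₁ x)^2 = 1)
    (hmin : ∀ (l : ℝ) (u : Pt → ℝ), ContDiff ℝ (⊤ : ℕ∞) u → (∃ x ∈ disk, u x ≠ 0) →
      (∀ x ∈ circ, u x = 0) → (∀ x ∈ disk, lap u x = -l * u x) → lam1 ≤ l) :
    ∃ Cstar > (0:ℝ), ∀ (k : ℕ) (f : Pt → ℝ), 3 ≤ k →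
      ContDiff ℝ (k : ℕ∞) f →
      (∀ x ∈ circ, f x = 0) →
      (∀ x ∈ disk, 0 < f x) →
      (sobN 0 f)^2 ≤ Cstar * (∫ x in disk, f x * φ₁ x) * sobN 3 f := by
  obtain ⟨c, hc, hhopf⟩ := hopf φ₁ lam1 hsmooth hlam hpos hbdry heigen
  have hvol : 0 ≤ volume.real disk := measureReal_nonneg
  refine ⟨16 * (1 + volume.real disk) / c, by positivity, fun k f hk hf hfb hfp => ?_⟩
  have hf3 : ContDiff ℝ (3:ℕ) f := hf.of_le (Nat.cast_le.2 hk : ((3:ℕ) : WithTop ℕ∞) ≤ ((k:ℕ) : WithTop ℕ∞))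
  have hsob0 : (sobN 0 f)^2 = ∫ x in disk, (f x)^2 := by
    have : sobN 0 f = √(∫ x in disk, (f x)^2) := by simp [sobN]
    rw [this, Real.sq_sqrt (integral_nonneg fun x => sq_nonneg _)]
  have hN0 : 0 ≤ sobN 3 f := Real.sqrt_nonneg _
  have hcφ := hsmooth.continuous
  have hcf := hf3.continuous
  rw [hsob0, mul_right_comm, ← integral_const_mul]
  refine setIntegral_mono_on (disk_int _ (by fun_prop)) (disk_int _ (by fun_prop))
    measurableSet_ball fun x hx => ?_
  have h1 := main_bound f hf3 hfb hfp x hx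
  have h2 := hhopf x hx
  have h3 := hfp x hx
  have h4 : f x ≤ 16 * (1 + volume.real disk) / c * sobN 3 f * φ₁ x := by
    calc f x ≤ 16 * (1 + volume.real disk) * sobN 3 f * (1 - ‖x‖) := h1
      _ = 16 * (1 + volume.real disk) / c * sobN 3 f * (c * (1 - ‖x‖)) := by field_simp
      _ ≤ _ := by gcongr
  nlinarith

end
end

section
/- Eigenfunction coefficient bound (Corollary 2.2). Let q₀ ∈ H⁴(Ω) ∩ H₀¹(Ω) with q₀ > 0 in Ω, and let q₀ = Σ_{j≥1} c_j φ_j be its expansion with respect to the L²-orthonormal basis {φ₁, φ₂, ...} of Dirichlet-Laplacian eigenfunctions on the unit disk Ω = B(0,1) ⊂ ℝ². If ‖q₀‖_{H⁴(Ω)}/‖q₀‖_{L²(Ω)} ≤ K, then there is a universal constant C (the constant of the weighted Poincaré inequality) such that |c_j| ≤ C K c₁ for every j = 1, 2, ..., where c₁ = ∫_Ω q₀ φ₁ dx > 0. -/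
noncomputable section
open MeasureTheory Set

/-! ### Second derivative test and Hopf's lemma -/

lemma second_deriv_test (f f' : ℝ → ℝ) (f'' : ℝ) (h1 : ∀ t, HasDerivAt f (f' t) t)
    (h2 : HasDerivAt f' f'' 0) (hmin : IsLocalMin f 0) : 0 ≤ f'' := by
  by_contra hneg
  push Not at hneg
  have hd : deriv f = f' := funext fun t => (h1 t).deriv
  have h0 : f' 0 = 0 := hmin.hasDerivAt_eq_zero (h1 0)
  have hmax : IsLocalMax f 0 := by
    apply isLocalMax_of_deriv_deriv_neg
    · rw [hd, h2.deriv]; exact hneg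
    · rw [hd]; exact h0
    · exact (h1 0).continuousAt
  have hc : f =ᶠ[nhds 0] fun _ => f 0 := by
    filter_upwards [hmin, hmax] with t h3 h4 using le_antisymm h4 h3
  have hc' : f' =ᶠ[nhds 0] fun _ => 0 := by
    have := hc.deriv
    rw [hd] at this
    simpa using this
  have := hc'.hasDerivAt_iff.1 h2
  have := this.unique (hasDerivAt_const (0:ℝ) (0:ℝ))
  linarith

lemma pdX_contDiff {n m : WithTop ℕ∞} {f : Pt → ℝ} (hf : ContDiff ℝ m f) (h : n + 1 ≤ m)
    (i : Fin 2) : ContDiff ℝ n (pdX i f) := by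
  unfold pdX
  exact (hf.fderiv_right h).clm_apply contDiff_const

lemma lap_eq (f : Pt → ℝ) (x : Pt) : lap f x = pdX 0 (pdX 0 f) x + pdX 1 (pdX 1 f) x := by
  unfold lap pdX
  rw [Fin.sum_univ_two]

lemma hasDerivAt_line {f : Pt → ℝ} (hf : ContDiff ℝ 1 f) (x : Pt) (i : Fin 2) (t : ℝ) :
    HasDerivAt (fun t : ℝ => f (x + t • basis2 i)) (pdX i f (x + t • basis2 i)) t := by
  have h1 : HasFDerivAt f (fderiv ℝ f (x + t • basis2 i)) (x + t • basis2 i) :=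
    ((hf.differentiable (by norm_num)) _).hasFDerivAt
  have h2 : HasDerivAt (fun t : ℝ => x + t • basis2 i) (basis2 i) t := by
    simpa using ((hasDerivAt_id t).smul_const (basis2 i)).const_add x
  exact h1.comp_hasDerivAt t h2

lemma norm_sq_pt (x : Pt) : ‖x‖ ^ 2 = x 0 ^ 2 + x 1 ^ 2 := by
  rw [EuclideanSpace.norm_sq_eq, Fin.sum_univ_two]; simp

lemma norm_sq_line (x : Pt) (i : Fin 2) (t : ℝ) :
    ‖x + t • basis2 i‖ ^ 2 = ‖x‖ ^ 2 + 2 * t * x i + t ^ 2 := by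
  rw [norm_sq_pt, norm_sq_pt]
  fin_cases i <;> simp [basis2] <;> ring

lemma barrier_step {u : Pt → ℝ} (hu : ContDiff ℝ 2 u) (y x : Pt) (R ε : ℝ) (hR : 0 < R)
    (hε : 0 < ε) (hx : 3 / 4 * R ^ 2 ≤ ‖x - y‖ ^ 2)
    (hlap : lap u x ≤ 0)
    (hmin : IsLocalMin (fun z => u z - ε * (R ^ 2 * (R ^ 2 - ‖z - y‖ ^ 2)
      + 2 * (R ^ 2 - ‖z - y‖ ^ 2) ^ 2)) x) : False := by
  have key : ∀ i : Fin 2, 0 ≤ pdX i (pdX i u) x - ε * (-2 * R ^ 2 + 16 * (x - y) i ^ 2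
      - 8 * (R ^ 2 - ‖x - y‖ ^ 2)) := by
    intro i
    set d := (x - y) i with hd
    set q := R ^ 2 - ‖x - y‖ ^ 2 with hq
    have e1 : ∀ t : ℝ, R ^ 2 - ‖(x + t • basis2 i) - y‖ ^ 2 = q - 2 * t * d - t ^ 2 := by
      intro t
      have : (x + t • basis2 i) - y = (x - y) + t • basis2 i := by abel
      rw [this, norm_sq_line, hq, hd]; ring
    apply second_deriv_test (fun t => u (x + t • basis2 i) - ε * (R ^ 2 * (q - 2 * t * d - t ^ 2)
      + 2 * (q - 2 * t * d - t ^ 2) ^ 2)) (fun t => pdX i u (x + t • basis2 i) -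
        ε * (R ^ 2 * (- 2 * d - 2 * t)
      + 4 * (q - 2 * t * d - t ^ 2) * (- 2 * d - 2 * t)))
    · intro t
      have h0 : HasDerivAt (fun t : ℝ => q - 2 * t * d - t ^ 2) (- 2 * d - 2 * t) t := by
        have := ((((hasDerivAt_id' t).const_mul 2).mul_const d).const_sub q).sub (hasDerivAt_pow 2 t)
        exact this.congr_deriv (by norm_num)
      have h1 := (hasDerivAt_line (hu.of_le (by norm_num)) x i t).sub
        (((h0.const_mul (R ^ 2)).add ((h0.pow 2).const_mul 2)).const_mul ε)
      exact h1.congr_deriv (by push_cast; ring)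
    · have h0 : HasDerivAt (fun t : ℝ => q - 2 * t * d - t ^ 2) (- 2 * d) 0 := by
        have := ((((hasDerivAt_id' (0:ℝ)).const_mul 2).mul_const d).const_sub q).sub
          (hasDerivAt_pow 2 (0:ℝ))
        exact this.congr_deriv (by norm_num)
      have h3 : HasDerivAt (fun t : ℝ => - 2 * d - 2 * t) (-2) 0 := by
        have := ((hasDerivAt_id' (0:ℝ)).const_mul (2)).const_sub (-2 * d)
        exact this.congr_deriv (by norm_num)
      have hp : HasDerivAt (fun t : ℝ => pdX i u (x + t • basis2 i)) (pdX i (pdX i u) x) 0 := by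
        have := hasDerivAt_line (pdX_contDiff (n := 1) hu (by norm_num) i) x i 0
        simpa using this
      have h1 := hp.sub
        (((h3.const_mul (R ^ 2)).add ((h0.const_mul 4).mul h3)).const_mul ε)
      exact h1.congr_deriv (by norm_num; left; ring)
    · have hc : Filter.Tendsto (fun t : ℝ => x + t • basis2 i) (nhds 0) (nhds x) := by
        have : Continuous (fun t : ℝ => x + t • basis2 i) := by fun_prop
        simpa using this.tendsto 0
      have := hc.eventually hmin
      filter_upwards [this] with t ht
      simp only [e1] at ht
      simpa using ht
  have k0 := key 0
  have k1 := key 1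
  rw [lap_eq] at hlap
  have hn := norm_sq_pt (x - y)
  set d0 := (x - y) 0
  set d1 := (x - y) 1
  have : 0 < R ^ 2 := by positivity
  have : 0 < ε * (32 * ‖x - y‖ ^ 2 - 20 * R ^ 2) := mul_pos hε (by linarith)
  rw [hn] at k0 k1 this
  nlinarith

lemma hopf_ball {u : Pt → ℝ} (hu : ContDiff ℝ 2 u) (y : Pt) (R : ℝ) (hR : 0 < R)
    (hlap : ∀ x ∈ Metric.ball y R, lap u x ≤ 0)
    (hpos : ∀ x ∈ Metric.ball y R, 0 < u x)
    (hnn : ∀ x ∈ Metric.sphere y R, 0 ≤ u x) :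
    ∃ c > 0, ∀ x ∈ Metric.ball y R, c * (R ^ 2 - ‖x - y‖ ^ 2) ≤ u x := by
  -- lower bound on the inner ball
  have hr : (9:ℝ) / 10 * R < R := by linarith
  obtain ⟨x₀, hx₀, hmin₀⟩ := (isCompact_closedBall y (9 / 10 * R)).exists_isMinOn
    (Metric.nonempty_closedBall.2 (by positivity)) hu.continuous.continuousOn
  set m := u x₀ with hm
  have hmpos : 0 < m := hpos _ (Metric.closedBall_subset_ball hr hx₀)
  set ε := m / (3 * R ^ 4) with hε
  have hεpos : 0 < ε := by positivity
  set h : Pt → ℝ := fun z => R ^ 2 * (R ^ 2 - ‖z - y‖ ^ 2) + 2 * (R ^ 2 - ‖z - y‖ ^ 2) ^ 2 with hh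
  have hhc : Continuous h := by rw [hh]; fun_prop
  have inner : ∀ x ∈ Metric.closedBall y (9 / 10 * R), 0 ≤ u x - ε * h x := by
    intro x hx
    have h1 : m ≤ u x := hmin₀ hx
    have hxR : ‖x - y‖ ≤ 9 / 10 * R := by simpa [dist_eq_norm] using hx
    have hle : h x ≤ 3 * R ^ 4 := by
      have : ‖x - y‖ ^ 2 ≤ R ^ 2 := by gcongr; linarith
      have h0 : 0 ≤ ‖x - y‖ ^ 2 := by positivity
      simp only [hh]
      nlinarith [mul_nonneg h0 (sub_nonneg.2 this), mul_nonneg h0 (sq_nonneg R)]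
    have : ε * h x ≤ m := by
      calc ε * h x ≤ ε * (3 * R ^ 4) := by gcongr
        _ = m := by rw [hε]; field_simp
    linarith
  have main : ∀ x ∈ Metric.closedBall y R, 0 ≤ u x - ε * h x := by
    obtain ⟨x₁, hx₁, hmin₁⟩ := (isCompact_closedBall y R).exists_isMinOn
      (Metric.nonempty_closedBall.2 hR.le) (f := fun x => u x - ε * h x)
      (hu.continuous.sub (continuous_const.mul hhc)).continuousOn
    suffices 0 ≤ u x₁ - ε * h x₁ from fun x hx => this.trans (hmin₁ hx)
    by_cases hin : x₁ ∈ Metric.closedBall y (9 / 10 * R)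
    · exact inner _ hin
    by_cases hb : x₁ ∈ Metric.ball y R
    · exfalso
      have hl : 9 / 10 * R < ‖x₁ - y‖ := by simpa [dist_eq_norm] using hin
      refine barrier_step hu y x₁ R ε hR hεpos ?_ (hlap _ hb) ?_
      · nlinarith
      · exact hmin₁.isLocalMin
          (Filter.mem_of_superset (Metric.isOpen_ball.mem_nhds hb) Metric.ball_subset_closedBall)
    · have hs : x₁ ∈ Metric.sphere y R := by
        simp only [Metric.mem_closedBall, Metric.mem_ball, Metric.mem_sphere] at *
        linarith
      have h1 := hnn _ hs
      have hn : ‖x₁ - y‖ = R := by simpa [dist_eq_norm] using hs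
      have : h x₁ = 0 := by simp only [hh]; rw [hn]; ring
      rw [this]; linarith
  refine ⟨ε * R ^ 2, by positivity, fun x hx => ?_⟩
  have h1 := main x (Metric.ball_subset_closedBall hx)
  have : ε * R ^ 2 * (R ^ 2 - ‖x - y‖ ^ 2) ≤ ε * h x := by
    rw [mul_assoc]
    gcongr
    simp only [hh]
    nlinarith [sq_nonneg (R ^ 2 - ‖x - y‖ ^ 2)]
  linarith

lemma strong_min {u : Pt → ℝ} (hu : ContDiff ℝ 2 u)
    (hlap : ∀ x ∈ disk, lap u x ≤ 0) (hnn : ∀ x ∈ disk, 0 ≤ u x) :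
    (∀ x ∈ disk, u x = 0) ∨ (∀ x ∈ disk, 0 < u x) := by
  by_contra hcon
  push Not at hcon
  obtain ⟨⟨x₀, hx₀, hux₀⟩, ⟨z₀, hz₀, huz₀⟩⟩ := hcon
  have hdo : IsOpen disk := Metric.isOpen_ball
  -- find a zero which is a limit of nonzeros
  have hz1 : ∃ z ∈ disk, u z = 0 ∧ ∀ r > 0, ∃ y ∈ Metric.ball z r, u y ≠ 0 := by
    by_contra hno
    push Not at hno
    have hpre : IsPreconnected disk := (convex_ball (0:Pt) 1).isPreconnected
    have := hpre {x | 0 < u x} (interior {x | u x = 0})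
      (isOpen_lt continuous_const hu.continuous) isOpen_interior ?_ ?_ ?_
    · obtain ⟨x, -, hx1, hx2⟩ := this
      have := interior_subset hx2
      simp only [mem_ofPred_eq] at hx1 this
      linarith
    · intro x hx
      rcases (hnn x hx).lt_or_eq with h | h
      · exact Or.inl h
      · right
        obtain ⟨r, hr, hball⟩ := hno x hx h.symm
        rw [mem_interior_iff_mem_nhds]
        exact Filter.mem_of_superset (Metric.ball_mem_nhds x hr) hball
    · exact ⟨x₀, hx₀, lt_of_le_of_ne (hnn _ hx₀) (Ne.symm hux₀)⟩
    · have h : u z₀ = 0 := le_antisymm huz₀ (hnn _ hz₀)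
      obtain ⟨r, hr, hball⟩ := hno z₀ hz₀ h
      refine ⟨z₀, hz₀, ?_⟩
      rw [mem_interior_iff_mem_nhds]
      exact Filter.mem_of_superset (Metric.ball_mem_nhds z₀ hr) hball
  obtain ⟨z1, hz1d, hz10, hz1n⟩ := hz1
  obtain ⟨d, hd, hdball⟩ := Metric.isOpen_iff.1 hdo z1 hz1d
  obtain ⟨y, hy, huy⟩ := hz1n (d / 2) (by positivity)
  have hZ : IsClosed {x | u x = 0} := isClosed_eq hu.continuous continuous_const
  obtain ⟨z, hz, hzd⟩ := hZ.exists_infDist_eq_dist ⟨z1, hz10⟩ y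
  set R := dist y z with hR
  have hRle : R < d / 2 := by
    rw [← hzd]
    exact (Metric.infDist_le_dist_of_mem (y := z1) hz10).trans_lt (Metric.mem_ball.1 hy)
  have hRpos : 0 < R := by
    rw [hR]; apply dist_pos.2
    rintro rfl; exact huy hz
  have hsub : Metric.closedBall y R ⊆ disk := by
    intro x hx
    apply hdball
    have h1 : dist x y ≤ R := hx
    have h2 : dist y z1 < d / 2 := hy
    have := dist_triangle x y z1
    simp only [Metric.mem_ball]; linarith
  have hzdisk : z ∈ disk := hsub (by simp [hR, dist_comm])
  obtain ⟨c, hc, hcb⟩ := hopf_ball hu y R hRpos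
    (fun x hx => hlap x (hsub (Metric.ball_subset_closedBall hx)))
    (fun x hx => by
      refine lt_of_le_of_ne (hnn x (hsub (Metric.ball_subset_closedBall hx))) (fun h0 => ?_)
      have h1 := Metric.infDist_le_dist_of_mem (x := y) (s := {x | u x = 0}) (y := x) h0.symm
      rw [hzd] at h1
      have h2 : dist x y < R := hx
      rw [dist_comm] at h2; linarith)
    (fun x hx => hnn x (hsub (Metric.sphere_subset_closedBall hx)))
  have hlm : IsLocalMin u z := by
    filter_upwards [hdo.mem_nhds hzdisk] with x hx
    have : u z = 0 := hz
    rw [this]; exact hnn x hx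
  have hfd : fderiv ℝ u z = 0 := hlm.fderiv_eq_zero
  have hder : HasDerivAt (fun s : ℝ => u (z + s • (y - z))) 0 0 := by
    have h1 : HasFDerivAt u (0 : Pt →L[ℝ] ℝ) (z + (0:ℝ) • (y - z)) := by
      rw [← hfd]; simpa using (hu.differentiable (by norm_num) z).hasFDerivAt
    have h2 : HasDerivAt (fun t : ℝ => z + t • (y - z)) (y - z) 0 := by
      simpa using ((hasDerivAt_id (0:ℝ)).smul_const (y - z)).const_add z
    exact (h1.comp_hasDerivAt 0 h2).congr_deriv (by simp)
  have hlow : ∀ s ∈ Ioo (0:ℝ) 1, c * R ^ 2 * s ≤ u (z + s • (y - z)) := by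
    intro s hs
    have e : (z + s • (y - z)) - y = (1 - s) • (z - y) := by module
    have en : ‖(z + s • (y - z)) - y‖ = (1 - s) * R := by
      rw [e, norm_smul, Real.norm_of_nonneg (by linarith [hs.2]), hR, dist_comm, dist_eq_norm]
    have h1 := hcb (z + s • (y - z)) (by
      rw [Metric.mem_ball, dist_eq_norm, en]; nlinarith [hs.1, hs.2])
    rw [en] at h1
    refine le_trans ?_ h1
    have : R ^ 2 * s ≤ R ^ 2 - ((1 - s) * R) ^ 2 := by
      have : 0 ≤ R ^ 2 * (s * (1 - s)) := by
        have := hs.1; have := hs.2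
        exact mul_nonneg (by positivity) (mul_nonneg (by linarith) (by linarith))
      nlinarith
    rw [mul_assoc]; gcongr
  have ht := hder.tendsto_slope_zero_right
  have : c * R ^ 2 ≤ 0 := by
    refine ge_of_tendsto ht ?_
    filter_upwards [Ioo_mem_nhdsGT (zero_lt_one (α := ℝ))] with s hs
    have h1 := hlow s hs
    have h0 : u z = 0 := hz
    simp only [zero_add, zero_smul, add_zero, h0, sub_zero, smul_eq_mul]
    rw [inv_mul_eq_div, le_div_iff₀ hs.1]
    exact h1
  have : 0 < c * R ^ 2 := by positivity
  linarith

lemma hopf_disk {u : Pt → ℝ} (hu : ContDiff ℝ 2 u)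
    (hlap : ∀ x ∈ disk, lap u x ≤ 0) (hpos : ∀ x ∈ disk, 0 < u x)
    (hz : ∀ x ∈ circ, u x = 0) :
    ∃ c > 0, ∀ x ∈ disk, c * (1 - ‖x‖) ≤ u x := by
  obtain ⟨c, hc, h⟩ := hopf_ball hu 0 1 one_pos hlap hpos (fun x hx => (hz x hx).ge)
  refine ⟨c, hc, fun x hx => le_trans ?_ (h x hx)⟩
  have hx1 : ‖x‖ < 1 := by simpa [disk] using hx
  rw [sub_zero]
  refine mul_le_mul_of_nonneg_left ?_ hc.le
  nlinarith [norm_nonneg x]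

/-! ### Boundary Lipschitz bound and uniqueness of the ground state -/

lemma fderiv_apply_eq (f : Pt → ℝ) (x v : Pt) :
    fderiv ℝ f x v = ∑ i, v i * pdX i f x := by
  have hv : v = ∑ i, v i • basis2 i := by
    ext j
    fin_cases j <;> simp [basis2, Fin.sum_univ_two]
  conv_lhs => rw [hv]
  simp [pdX]

lemma abs_coord_le (v : Pt) (i : Fin 2) : |v i| ≤ ‖v‖ := by
  simpa using PiLp.norm_apply_le v i

lemma lip_bound {f : Pt → ℝ} (hf : ContDiff ℝ 1 f) (M : ℝ) (hz : ∀ x ∈ circ, f x = 0)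
    (hM : ∀ i, ∀ x ∈ Metric.closedBall (0:Pt) 1, |pdX i f x| ≤ M) :
    ∀ x ∈ disk, f x ≤ 2 * M * (1 - ‖x‖) := by
  have hM0 : 0 ≤ M := (abs_nonneg _).trans (hM 0 0 (by simp))
  intro x hx
  have hx1 : ‖x‖ < 1 := by simpa [disk] using hx
  obtain ⟨y, hy, hxy⟩ : ∃ y : Pt, ‖y‖ = 1 ∧ ‖x - y‖ = 1 - ‖x‖ := by
    by_cases h0 : x = 0
    · refine ⟨basis2 0, by simp [basis2], by simp [h0, basis2]⟩
    · have hn : 0 < ‖x‖ := norm_pos_iff.2 h0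
      refine ⟨‖x‖⁻¹ • x, by simp [norm_smul, hn.ne'], ?_⟩
      have : x - ‖x‖⁻¹ • x = (1 - ‖x‖⁻¹) • x := by module
      rw [this, norm_smul, Real.norm_eq_abs, abs_of_nonpos]
      · field_simp; ring
      · have : 1 ≤ ‖x‖⁻¹ := (one_le_inv₀ hn).2 hx1.le
        linarith
  have hmv := (convex_closedBall (0:Pt) 1).norm_image_sub_le_of_norm_fderiv_le (𝕜 := ℝ)
    (f := f) (C := 2 * M) (x := y) (y := x)
    (fun z _ => hf.differentiable (by norm_num) z)
    (fun z hz => by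
      apply ContinuousLinearMap.opNorm_le_bound _ (by positivity)
      intro v
      rw [fderiv_apply_eq, Fin.sum_univ_two, Real.norm_eq_abs]
      refine (abs_add_le _ _).trans ?_
      rw [abs_mul, abs_mul]
      have h0 := mul_le_mul (abs_coord_le v 0) (hM 0 z hz) (abs_nonneg _) (norm_nonneg _)
      have h1 := mul_le_mul (abs_coord_le v 1) (hM 1 z hz) (abs_nonneg _) (norm_nonneg _)
      linarith)
    (by simp [hy]) (by simp [hx1.le])
  rw [hz y (by simp [circ, hy]), hxy, sub_zero] at hmv
  exact (le_abs_self _).trans hmv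

lemma exists_lip_bound {f : Pt → ℝ} (hf : ContDiff ℝ 1 f) (hz : ∀ x ∈ circ, f x = 0) :
    ∃ L > 0, ∀ x ∈ disk, f x ≤ L * (1 - ‖x‖) := by
  have h : ∀ i, ∃ M, ∀ x ∈ Metric.closedBall (0:Pt) 1, ‖pdX i f x‖ ≤ M := fun i =>
    (isCompact_closedBall (0:Pt) 1).exists_bound_of_continuousOn
      (pdX_contDiff (n := 0) hf (by norm_num) i).continuous.continuousOn
  obtain ⟨M0, h0⟩ := h 0
  obtain ⟨M1, h1⟩ := h 1
  have := lip_bound hf (max (max M0 M1) 1) hz (fun i x hx => by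
    fin_cases i
    · exact (h0 x hx).trans ((le_max_left _ _).trans (le_max_left _ _))
    · exact (h1 x hx).trans ((le_max_right _ _).trans (le_max_left _ _)))
  exact ⟨_, by positivity, this⟩

/-- A positive normalized Dirichlet eigenfunction on the disk. -/
structure GroundState (f : Pt → ℝ) (l : ℝ) : Prop where
  smooth : ContDiff ℝ 2 f
  zero : ∀ x ∈ circ, f x = 0
  eig : ∀ x ∈ disk, lap f x = -l * f x
  norm : (∫ x in disk, f x * f x) = 1
  pos : ∀ x ∈ disk, 0 < f x
  lpos : 0 < l

lemma lap_sub_mul {f g : Pt → ℝ} (hf : ContDiff ℝ 2 f) (hg : ContDiff ℝ 2 g) (t : ℝ) (x : Pt) :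
    lap (fun y => g y - t * f y) x = lap g x - t * lap f x := by
  have step : ∀ (a b : Pt → ℝ) (i : Fin 2), ContDiff ℝ 1 a → ContDiff ℝ 1 b →
      pdX i (fun y => b y - t * a y) = fun y => pdX i b y - t * pdX i a y := by
    intro a b i ha hb
    funext y
    have h1 := (ha.differentiable (by norm_num) y).hasFDerivAt
    have h2 := (hb.differentiable (by norm_num) y).hasFDerivAt
    have h3 := h2.sub (h1.const_mul t)
    have : fderiv ℝ (fun y => b y - t * a y) y = _ := h3.fderiv
    simp [pdX, this]
  have c1 : ∀ i, ContDiff ℝ 1 (pdX i f) := pdX_contDiff hf (by norm_num)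
  have c2 : ∀ i, ContDiff ℝ 1 (pdX i g) := pdX_contDiff hg (by norm_num)
  have hf1 : ContDiff ℝ 1 f := hf.of_le (by norm_num)
  have hg1 : ContDiff ℝ 1 g := hg.of_le (by norm_num)
  simp only [lap_eq, step _ _ _ hf1 hg1, step _ _ _ (c1 _) (c2 _)]
  ring

lemma ground_unique_aux {f g : Pt → ℝ} {l m : ℝ} (hf : GroundState f l) (hg : GroundState g m)
    (hlm : l ≤ m) : ∀ x ∈ disk, g x = f x := by
  set T : Set ℝ := {t | ∀ x ∈ disk, t * f x ≤ g x} with hT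
  have h0d : (0:Pt) ∈ disk := by simp [disk]
  have h0T : (0:ℝ) ∈ T := fun x hx => by simpa using (hg.pos x hx).le
  have hbdd : BddAbove T := ⟨g 0 / f 0, fun t ht => by
    rw [le_div_iff₀ (hf.pos 0 h0d)]; exact ht 0 h0d⟩
  set t := sSup T with ht
  have ht0 : 0 ≤ t := le_csSup hbdd h0T
  have htT : ∀ x ∈ disk, t * f x ≤ g x := by
    intro x hx
    rw [← le_div_iff₀ (hf.pos x hx)]
    apply csSup_le ⟨0, h0T⟩
    intro s hs
    rw [le_div_iff₀ (hf.pos x hx)]; exact hs x hx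
  set u : Pt → ℝ := fun y => g y - t * f y with hu
  have hus : ContDiff ℝ 2 u := hg.smooth.sub (contDiff_const.mul hf.smooth)
  have hunn : ∀ x ∈ disk, 0 ≤ u x := fun x hx => sub_nonneg.2 (htT x hx)
  have hulap : ∀ x ∈ disk, lap u x ≤ 0 := by
    intro x hx
    rw [hu, lap_sub_mul hf.smooth hg.smooth, hf.eig x hx, hg.eig x hx]
    have h1 := mul_nonneg hf.lpos.le (hunn x hx)
    have h2 := mul_nonneg (sub_nonneg.2 hlm) (hg.pos x hx).le
    simp only [hu] at h1
    nlinarith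
  rcases strong_min hus hulap hunn with h | h
  · have e : ∀ x ∈ disk, g x = t * f x := fun x hx => sub_eq_zero.1 (h x hx)
    have h1 : (∫ x in disk, g x * g x) = ∫ x in disk, t ^ 2 * (f x * f x) := by
      apply setIntegral_congr_fun Metric.isOpen_ball.measurableSet
      intro x hx
      simp only [e x hx]; ring
    rw [integral_const_mul, hf.norm, hg.norm] at h1
    have : t = 1 := by nlinarith
    intro x hx
    rw [e x hx, this, one_mul]
  · exfalso
    obtain ⟨c, hc, hcb⟩ := hopf_disk hus hulap h (fun x hx => by
      simp [hu, hf.zero x hx, hg.zero x hx])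
    obtain ⟨L, hL, hLb⟩ := exists_lip_bound (hf.smooth.of_le (by norm_num)) hf.zero
    have : t + c / L ∈ T := by
      intro x hx
      have h1 := hcb x hx
      have h2 : c / L * f x ≤ c / L * (L * (1 - ‖x‖)) := by gcongr; exact hLb x hx
      have h3 : c / L * (L * (1 - ‖x‖)) = c * (1 - ‖x‖) := by field_simp
      simp only [hu] at h1
      linarith
    have h4 := le_csSup hbdd this
    have : 0 < c / L := by positivity
    linarith

lemma ground_unique {f g : Pt → ℝ} {l m : ℝ} (hf : GroundState f l) (hg : GroundState g m) :
    ∀ x ∈ disk, g x = f x := by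
  rcases le_total l m with h | h
  · exact ground_unique_aux hf hg h
  · exact fun x hx => (ground_unique_aux hg hf h x hx).symm

lemma ground_lower : ∃ c > (0:ℝ), ∀ f l, GroundState f l → ∀ x ∈ disk, c * (1 - ‖x‖) ≤ f x := by
  by_cases h : ∃ f l, GroundState f l
  · obtain ⟨f, l, hf⟩ := h
    obtain ⟨c, hc, hcb⟩ := hopf_disk hf.smooth (fun x hx => by
      rw [hf.eig x hx]
      have := mul_pos hf.lpos (hf.pos x hx)
      linarith) hf.pos hf.zero
    refine ⟨c, hc, fun g m hg x hx => ?_⟩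
    rw [ground_unique hf hg x hx]
    exact hcb x hx
  · exact ⟨1, one_pos, fun f l hf => absurd ⟨f, l, hf⟩ h⟩

/-! ### Sobolev embedding on the disk -/

lemma intOn {h : Pt → ℝ} (hh : Continuous h) : IntegrableOn h disk :=
  (hh.continuousOn.integrableOn_compact (isCompact_closedBall (0:Pt) 1)).mono_set
    Metric.ball_subset_closedBall

/-- The `L²` norm on the disk. -/
def nrm (h : Pt → ℝ) : ℝ := Real.sqrt (∫ x in disk, h x ^ 2)

lemma nrm_nonneg (h : Pt → ℝ) : 0 ≤ nrm h := Real.sqrt_nonneg _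

lemma nrm_sq (h : Pt → ℝ) : nrm h ^ 2 = ∫ x in disk, h x ^ 2 :=
  Real.sq_sqrt (integral_nonneg fun _ => sq_nonneg _)

lemma cauchy_schwarz {a b : Pt → ℝ} (ha : Continuous a) (hb : Continuous b) :
    |∫ x in disk, a x * b x| ≤ nrm a * nrm b := by
  have hq : ∀ s : ℝ, 0 ≤ (∫ x in disk, b x ^ 2) * (s * s) + (2 * ∫ x in disk, a x * b x) * s
      + ∫ x in disk, a x ^ 2 := by
    intro s
    have h0 : 0 ≤ ∫ x in disk, (a x + s * b x) ^ 2 := integral_nonneg fun _ => sq_nonneg _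
    have e : (fun x => (a x + s * b x) ^ 2) =
        fun x => (a x ^ 2 + (2 * s) * (a x * b x)) + (s * s) * b x ^ 2 := by funext x; ring
    rw [e, integral_add, integral_add, integral_const_mul, integral_const_mul] at h0
    · linarith
    · exact intOn (by fun_prop)
    · exact intOn (by fun_prop)
    · exact intOn (by fun_prop)
    · exact intOn (by fun_prop)
  have hd := discrim_le_zero hq
  unfold discrim at hd
  apply abs_le_of_sq_le_sq _ (mul_nonneg (nrm_nonneg a) (nrm_nonneg b))
  rw [mul_pow, nrm_sq, nrm_sq]
  linarith

lemma cs_one {a : Pt → ℝ} (ha : Continuous a) :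
    ∫ x in disk, |a x| ≤ Real.sqrt (volume.real disk) * nrm a := by
  have h := cauchy_schwarz (a := fun _ => 1) (b := fun x => |a x|) continuous_const ha.abs
  have h1 : nrm (fun _ => (1:ℝ)) = Real.sqrt (volume.real disk) := by simp [nrm]
  have h2 : nrm (fun x => |a x|) = nrm a := by simp [nrm]
  rw [h1, h2] at h
  simp only [one_mul] at h
  exact (le_abs_self _).trans h

lemma param_deriv {h w : Pt → ℝ} (hh : ContDiff ℝ 1 h) (hw : Continuous w) (p : Pt) (t : ℝ) :
    HasDerivAt (fun t : ℝ => ∫ z in disk, w z * h (z + t • (p - z)))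
      (∑ i, ∫ z in disk, (w z * (p - z) i) * pdX i h (z + t • (p - z))) t := by
  have hpc : ∀ i, Continuous (pdX i h) := fun i =>
    (pdX_contDiff (n := 0) hh (by norm_num) i).continuous
  have hco : ∀ i : Fin 2, Continuous fun z : Pt => (p - z) i := fun i => by fun_prop
  have hhc := hh.continuous
  set F' : ℝ → Pt → ℝ := fun t z => ∑ i, (w z * (p - z) i) * pdX i h (z + t • (p - z)) with hF'
  have hF'c : Continuous (fun q : ℝ × Pt => F' q.1 q.2) := by
    simp only [hF']
    apply continuous_finsetSum
    intro i _
    apply Continuous.mul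
    · exact (hw.comp continuous_snd).mul ((hco i).comp continuous_snd)
    · exact (hpc i).comp (by fun_prop)
  obtain ⟨B, hB⟩ := ((isCompact_closedBall t 1).prod
    (isCompact_closedBall (0:Pt) 1)).exists_bound_of_continuousOn hF'c.continuousOn
  have main := hasDerivAt_integral_of_dominated_loc_of_deriv_le (μ := volume.restrict disk)
    (F := fun t z => w z * h (z + t • (p - z))) (F' := F') (x₀ := t) (s := Metric.ball t 1)
    (bound := fun _ => B) (Metric.ball_mem_nhds t one_pos)
    (Filter.Eventually.of_forall fun s => by
      have : Continuous fun z => w z * h (z + s • (p - z)) := by fun_prop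
      exact this.aestronglyMeasurable)
    (intOn (by fun_prop))
    (hF'c.comp (by fun_prop : Continuous fun z : Pt => (t, z))).aestronglyMeasurable
    (by
      filter_upwards [ae_restrict_mem (Metric.isOpen_ball.measurableSet)] with z hz s hs
      exact hB (s, z) ⟨Metric.ball_subset_closedBall hs, Metric.ball_subset_closedBall hz⟩)
    (intOn continuous_const)
    (by
      refine Filter.Eventually.of_forall fun z s _ => ?_
      have h1 : HasFDerivAt h (fderiv ℝ h (z + s • (p - z))) (z + s • (p - z)) :=
        ((hh.differentiable (by norm_num)) _).hasFDerivAt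
      have h2 : HasDerivAt (fun t : ℝ => z + t • (p - z)) (p - z) s := by
        simpa using ((hasDerivAt_id s).smul_const (p - z)).const_add z
      refine ((h1.comp_hasDerivAt s h2).const_mul (w z)).congr_deriv ?_
      rw [fderiv_apply_eq, Finset.mul_sum]
      simp only [hF', mul_assoc])
  refine main.2.congr_deriv ?_
  simp only [hF']
  rw [integral_finsetSum]
  intro i _
  apply intOn
  exact (hw.mul (hco i)).mul ((hpc i).comp (by fun_prop))

open scoped Pointwise in
lemma contract_bound {h : Pt → ℝ} (hh : Continuous h) (hnn : ∀ x, 0 ≤ h x) {p : Pt}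
    (hp : p ∈ Metric.closedBall (0:Pt) 1) {t : ℝ} (ht : t ∈ Ico (0:ℝ) 1) :
    ∫ z in disk, h (z + t • (p - z)) ≤ ((1 - t) ^ 2)⁻¹ * ∫ z in disk, h z := by
  have ht1 : 0 < 1 - t := by linarith [ht.2]
  have hp1 : ‖p‖ ≤ 1 := by simpa using hp
  have e : (fun z => h (z + t • (p - z))) = fun z => (fun y => h (y + t • p)) ((1 - t) • z) := by
    funext z; simp only; congr 1; module
  rw [e, Measure.setIntegral_comp_smul_of_pos volume (fun y => h (y + t • p)) disk ht1]
  have hfr : Module.finrank ℝ Pt = 2 := by simp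
  rw [hfr, smul_eq_mul]
  refine mul_le_mul_of_nonneg_left ?_ (by positivity)
  have hsub : (1 - t) • disk ⊆ (fun y => y + t • p) ⁻¹' disk := by
    rintro _ ⟨z, hz, rfl⟩
    have hz1 : ‖z‖ < 1 := by simpa [disk] using hz
    simp only [disk, mem_preimage, Metric.mem_ball, dist_zero_right]
    calc ‖(1 - t) • z + t • p‖ ≤ (1 - t) * ‖z‖ + t * ‖p‖ := by
          refine (norm_add_le _ _).trans ?_
          rw [norm_smul, norm_smul, Real.norm_of_nonneg ht1.le, Real.norm_of_nonneg ht.1]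
      _ < 1 := by nlinarith [mul_lt_mul_of_pos_left hz1 ht1, mul_le_mul_of_nonneg_left hp1 ht.1]
  have hmp : MeasurePreserving (fun y : Pt => y + t • p) volume volume :=
    measurePreserving_add_right volume (t • p)
  have hemb : MeasurableEmbedding (fun y : Pt => y + t • p) :=
    (Homeomorph.addRight (t • p)).measurableEmbedding
  rw [← hmp.setIntegral_preimage_emb hemb h disk]
  apply setIntegral_mono_set
  · exact (hmp.integrableOn_comp_preimage hemb).2 (intOn hh)
  · exact Filter.Eventually.of_forall fun x => hnn _
  · exact hsub.eventuallyLE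

lemma contract_l1 {h : Pt → ℝ} (hh : Continuous h) {p : Pt}
    (hp : p ∈ Metric.closedBall (0:Pt) 1) {t : ℝ} (ht : t ∈ Ico (0:ℝ) 1) :
    (1 - t) * ∫ z in disk, |h (z + t • (p - z))| ≤ Real.sqrt (volume.real disk) * nrm h := by
  have ht1 : 0 < 1 - t := by linarith [ht.2]
  have h1 := cs_one (a := fun z => h (z + t • (p - z))) (by fun_prop)
  have h2 := contract_bound (h := fun z => h z ^ 2) (by fun_prop) (fun _ => sq_nonneg _) hp ht
  have h3 : nrm (fun z => h (z + t • (p - z))) ≤ (1 - t)⁻¹ * nrm h := by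
    apply le_of_sq_le_sq _ (mul_nonneg (by positivity) (nrm_nonneg _))
    rw [mul_pow, nrm_sq, nrm_sq, inv_pow]
    exact h2
  calc _ ≤ (1 - t) * (Real.sqrt (volume.real disk) * ((1 - t)⁻¹ * nrm h)) := by
        gcongr
        exact h1.trans (by gcongr)
    _ = _ := by field_simp

lemma weighted_abs {h w : Pt → ℝ} {W : ℝ} (hh : Continuous h) (hw : Continuous w)
    (hW : ∀ z ∈ disk, |w z| ≤ W) :
    |∫ z in disk, w z * h z| ≤ W * ∫ z in disk, |h z| := by
  refine (abs_integral_le_integral_abs).trans ?_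
  rw [← integral_const_mul]
  apply setIntegral_mono_on (intOn (by fun_prop)) (intOn (by fun_prop))
    Metric.isOpen_ball.measurableSet
  intro z hz
  rw [abs_mul]
  exact mul_le_mul_of_nonneg_right (hW z hz) (abs_nonneg _)

lemma coord_bound {p : Pt} (hp : p ∈ Metric.closedBall (0:Pt) 1) (i : Fin 2) :
    ∀ z ∈ disk, |(p - z) i| ≤ 2 := by
  intro z hz
  have hp1 : ‖p‖ ≤ 1 := by simpa using hp
  have hz1 : ‖z‖ < 1 := by simpa [disk] using hz
  have := norm_sub_le p z
  have := abs_coord_le (p - z) i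
  linarith

lemma sobolev_sup {g : Pt → ℝ} (hg : ContDiff ℝ 2 g) {p : Pt}
    (hp : p ∈ Metric.closedBall (0:Pt) 1) :
    volume.real disk * |g p| ≤ Real.sqrt (volume.real disk) *
      (nrm g + 2 * ∑ i, nrm (pdX i g) + 4 * ∑ i, ∑ j, nrm (pdX j (pdX i g))) := by
  set S := Real.sqrt (volume.real disk) with hS
  have hg1 : ContDiff ℝ 1 g := hg.of_le (by norm_num)
  have hp1 : ∀ i, ContDiff ℝ 1 (pdX i g) := pdX_contDiff hg (by norm_num)
  have hp2 : ∀ i j, Continuous (pdX j (pdX i g)) := fun i j =>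
    (pdX_contDiff (n := 0) (hp1 i) (by norm_num) j).continuous
  have hco : ∀ i : Fin 2, Continuous fun z : Pt => (p - z) i := fun i => by fun_prop
  set F : ℝ → ℝ := fun t => ∫ z in disk, (1:ℝ) * g (z + t • (p - z)) with hF
  set F1 : ℝ → ℝ := fun t => ∑ i, ∫ z in disk, (1 * (p - z) i) * pdX i g (z + t • (p - z)) with hF1
  set F2 : ℝ → ℝ := fun t => ∑ i, ∑ j, ∫ z in disk, ((1 * (p - z) i) * (p - z) j) *
    pdX j (pdX i g) (z + t • (p - z)) with hF2
  have d1 : ∀ t, HasDerivAt F (F1 t) t := fun t =>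
    param_deriv (w := fun _ => 1) hg1 continuous_const p t
  have d2 : ∀ t, HasDerivAt F1 (F2 t) t := fun t => by
    have := HasDerivAt.fun_sum (u := Finset.univ) fun (i : Fin 2) _ =>
      param_deriv (w := fun z => 1 * (p - z) i) (hp1 i) (continuous_const.mul (hco i)) p t
    exact this
  have dG : ∀ t, HasDerivAt (fun t => F t + (1 - t) * F1 t) ((1 - t) * F2 t) t := fun t => by
    have := (d1 t).add ((((hasDerivAt_id' t).const_sub 1)).mul (d2 t))
    exact this.congr_deriv (by ring)
  have bound : ∀ t ∈ Ico (0:ℝ) 1, ‖(1 - t) * F2 t‖ ≤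
      S * (4 * ∑ i, ∑ j, nrm (pdX j (pdX i g))) := by
    intro t ht
    have ht1 : 0 < 1 - t := by linarith [ht.2]
    rw [Real.norm_eq_abs, abs_mul, abs_of_pos ht1]
    have : ∀ i j, (1 - t) * |∫ z in disk, ((1 * (p - z) i) * (p - z) j) *
        pdX j (pdX i g) (z + t • (p - z))| ≤ 4 * (S * nrm (pdX j (pdX i g))) := by
      intro i j
      have h2 := contract_l1 (hp2 i j) hp ht
      have h1 := weighted_abs (h := fun z => pdX j (pdX i g) (z + t • (p - z))) (W := 4)
        (w := fun z => (1 * (p - z) i) * (p - z) j)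
        ((hp2 i j).comp (by fun_prop)) ((continuous_const.mul (hco i)).mul (hco j))
        (fun z hz => by
          rw [one_mul, abs_mul]
          have := mul_le_mul (coord_bound hp i z hz) (coord_bound hp j z hz) (abs_nonneg _)
            (by norm_num)
          linarith)
      have h3 := mul_le_mul_of_nonneg_left h1 ht1.le
      linarith
    simp only [hF2]
    calc _ ≤ (1 - t) * ∑ i, ∑ j, |∫ z in disk, ((1 * (p - z) i) * (p - z) j) *
        pdX j (pdX i g) (z + t • (p - z))| := by
          refine mul_le_mul_of_nonneg_left ?_ ht1.le
          refine (Finset.abs_sum_le_sum_abs _ _).trans (Finset.sum_le_sum fun i _ => ?_)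
          exact Finset.abs_sum_le_sum_abs _ _
      _ ≤ ∑ i, ∑ j, 4 * (S * nrm (pdX j (pdX i g))) := by
          simp only [Finset.mul_sum]
          exact Finset.sum_le_sum fun i _ => Finset.sum_le_sum fun j _ => this i j
      _ = _ := by
          simp only [Finset.mul_sum]
          exact Finset.sum_congr rfl fun i _ => Finset.sum_congr rfl fun j _ => by ring
  have mv := norm_image_sub_le_of_norm_deriv_right_le_segment
    (f := fun t => F t + (1 - t) * F1 t) (f' := fun t => (1 - t) * F2 t) (a := 0) (b := 1)
    (fun t _ => (dG t).continuousAt.continuousWithinAt)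
    (fun t _ => (dG t).hasDerivWithinAt) bound 1 (by simp)
  have hF_1 : F 1 = volume.real disk * g p := by
    simp [hF]
  have hF0 : |F 0| ≤ S * nrm g := by
    simp only [hF, one_mul, zero_smul, add_zero]
    exact (abs_integral_le_integral_abs).trans (cs_one hg.continuous)
  have hF10 : |F1 0| ≤ S * (2 * ∑ i, nrm (pdX i g)) := by
    simp only [hF1, zero_smul, add_zero]
    refine (Finset.abs_sum_le_sum_abs _ _).trans ?_
    rw [Finset.mul_sum, Finset.mul_sum]
    refine Finset.sum_le_sum fun i _ => ?_
    have h1 := weighted_abs (h := pdX i g) (W := 2) (w := fun z => 1 * (p - z) i)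
      (hp1 i).continuous (continuous_const.mul (hco i))
      (fun z hz => by rw [one_mul]; exact coord_bound hp i z hz)
    have h2 := cs_one (hp1 i).continuous
    linarith
  rw [Real.norm_eq_abs] at mv
  have e : volume.real disk * |g p| = |F 1| := by
    rw [hF_1, abs_mul, abs_of_nonneg measureReal_nonneg]
  rw [e]
  have mv' : |F 1 - (F 0 + F1 0)| ≤ S * (4 * ∑ i, ∑ j, nrm (pdX j (pdX i g))) := by
    simpa using mv
  have t1 : |F 1| ≤ |F 1 - (F 0 + F1 0)| + (|F 0| + |F1 0|) := by
    have := abs_add_le (F 1 - (F 0 + F1 0)) (F 0 + F1 0)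
    have h2 := abs_add_le (F 0) (F1 0)
    rw [sub_add_cancel] at this
    linarith
  linarith

/-! ### Conclusion -/

lemma pdX_comm {f : Pt → ℝ} (hf : ContDiff ℝ 2 f) :
    pdX 1 (pdX 0 f) = pdX 0 (pdX 1 f) := by
  funext x
  have hs : IsSymmSndFDerivAt ℝ f x := hf.contDiffAt.isSymmSndFDerivAt (by simp)
  have hd : DifferentiableAt ℝ (fderiv ℝ f) x :=
    (hf.fderiv_right (m := 1) (by norm_num)).differentiable (by norm_num) x
  have e : ∀ i j, pdX j (pdX i f) x = fderiv ℝ (fderiv ℝ f) x (basis2 j) (basis2 i) := by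
    intro i j
    have h1 := hd.hasFDerivAt.clm_apply (hasFDerivAt_const (basis2 i) x)
    have h2 : fderiv ℝ (fun y => fderiv ℝ f y (basis2 i)) x = _ := h1.fderiv
    change fderiv ℝ (fun y => fderiv ℝ f y (basis2 i)) x (basis2 j) = _
    rw [h2]; simp
  rw [e, e]
  exact hs.eq _ _

lemma nrm_le_sobN (f : Pt → ℝ) (a b : ℕ) (hab : a + b ≤ 4) :
    nrm ((pdX 0)^[a] ((pdX 1)^[b] f)) ≤ sobN 4 f := by
  unfold nrm sobN
  apply Real.sqrt_le_sqrt
  have hnn : ∀ a b : ℕ, 0 ≤ (if a + b ≤ 4 then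
      ∫ x in disk, ((pdX 0)^[a] ((pdX 1)^[b] f) x) ^ 2 else 0) := by
    intro a b
    split_ifs
    · exact integral_nonneg fun _ => sq_nonneg _
    · exact le_rfl
  have h1 := Finset.single_le_sum (s := Finset.range (4 + 1)) (f := fun b => if a + b ≤ 4 then
      ∫ x in disk, ((pdX 0)^[a] ((pdX 1)^[b] f) x) ^ 2 else 0) (fun b _ => hnn a b)
      (a := b) (Finset.mem_range.2 (by omega))
  have h2 := Finset.single_le_sum (s := Finset.range (4 + 1)) (f := fun a =>
      ∑ b ∈ Finset.range (4 + 1), if a + b ≤ 4 then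
      ∫ x in disk, ((pdX 0)^[a] ((pdX 1)^[b] f) x) ^ 2 else 0)
      (fun a _ => Finset.sum_nonneg fun b _ => hnn a b)
      (a := a) (Finset.mem_range.2 (by omega))
  simp only [if_pos hab] at h1
  exact h1.trans h2

lemma grad_bound {f : Pt → ℝ} (hf : ContDiff ℝ 3 f) (i : Fin 2) {p : Pt}
    (hp : p ∈ Metric.closedBall (0:Pt) 1) :
    volume.real disk * |pdX i f p| ≤ Real.sqrt (volume.real disk) * (21 * sobN 4 f) := by
  have hf2 : ContDiff ℝ 2 f := hf.of_le (by norm_num)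
  have hp2 : ∀ i, ContDiff ℝ 2 (pdX i f) := pdX_contDiff hf (by norm_num)
  refine (sobolev_sup (hp2 i) hp).trans ?_
  refine mul_le_mul_of_nonneg_left ?_ (Real.sqrt_nonneg _)
  have B := nrm_le_sobN f
  have b10 := B 1 0 (by norm_num)
  have b01 := B 0 1 (by norm_num)
  have b20 := B 2 0 (by norm_num)
  have b11 := B 1 1 (by norm_num)
  have b02 := B 0 2 (by norm_num)
  have b30 := B 3 0 (by norm_num)
  have b21 := B 2 1 (by norm_num)
  have b12 := B 1 2 (by norm_num)
  have b03 := B 0 3 (by norm_num)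
  simp only [Function.iterate_succ, Function.iterate_zero, Function.comp, id] at *
  simp only [Fin.sum_univ_two]
  have c0 := pdX_comm hf2
  have c1 := pdX_comm (hp2 0)
  have c2 := pdX_comm (hp2 1)
  fin_cases i
  · simp only [Fin.zero_eta, c1, c0, c2]
    linarith
  · simp only [Fin.mk_one, c2]
    linarith

lemma vol_pos : 0 < volume.real disk := by
  apply ENNReal.toReal_pos
  · exact (Metric.measure_ball_pos volume (0:Pt) one_pos).ne'
  · exact measure_ball_lt_top.ne

lemma nrm_zero_eq (f : Pt → ℝ) : sobN 0 f = nrm f := by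
  simp [sobN, nrm]

/-- **Corollary 2.2** (eigenfunction coefficient bound). Let `{φ_j}` be the
`L²`-orthonormal basis of Dirichlet-Laplacian eigenfunctions on the unit disk (indexed
from `0`, so `φ 0 = φ₁` is the positive ground state) with eigenvalues `lam j`. If
`q₀ ∈ H⁴ ∩ H₀¹`, `q₀ > 0` in `Ω`, and `‖q₀‖₄/‖q₀‖₀ ≤ K`, then for a universal constant
`C` (the constant of the weighted Poincaré inequality), `|c_j| ≤ C K c₁` for all `j`,
where `c_j = ∫_Ω q₀ φ_j` and `c₁ = ∫_Ω q₀ φ₁ > 0`. -/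
theorem eigenfunction_coefficient_bound :
    ∃ C > (0:ℝ),
      ∀ (φ : ℕ → Pt → ℝ) (lam : ℕ → ℝ),
        (∀ j, ContDiff ℝ (⊤ : ℕ∞) (φ j)) →
        (∀ j, ∀ x ∈ circ, φ j x = 0) →
        (∀ j, ∀ x ∈ disk, lap (φ j) x = -(lam j) * φ j x) →
        (∀ i j, (∫ x in disk, φ i x * φ j x) = if i = j then (1:ℝ) else 0) →
        (∀ x ∈ disk, 0 < φ 0 x) →
        (0 < lam 0) →
        (∀ j, lam 0 ≤ lam j) →
        ∀ (q₀ : Pt → ℝ) (K : ℝ),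
          ContDiff ℝ (4 : ℕ∞) q₀ →
          (∀ x ∈ circ, q₀ x = 0) →
          (∀ x ∈ disk, 0 < q₀ x) →
          sobN 4 q₀ / sobN 0 q₀ ≤ K →
          ∀ j, |∫ x in disk, q₀ x * φ j x| ≤ C * K * ∫ x in disk, q₀ x * φ 0 x := by
  obtain ⟨c, hc, hlow⟩ := ground_lower
  set V := volume.real disk with hV
  have hVpos : 0 < V := vol_pos
  set C1 : ℝ := Real.sqrt V * 21 / V with hC1
  have hC1pos : 0 < C1 := by positivity
  refine ⟨2 * C1 / c, by positivity, ?_⟩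
  intro φ lam hsm hbd heig hort hpos hl0 _ q K hq hqz hqpos hK j
  have hgs : GroundState (φ 0) (lam 0) :=
    ⟨contDiff_infty.1 (hsm 0) 2, hbd 0, heig 0, by simpa using hort 0 0, hpos, hl0⟩
  have hq3 : ContDiff ℝ 3 q := hq.of_le (by norm_cast)
  have hqc : Continuous q := hq.continuous
  have hφc : ∀ j, Continuous (φ j) := fun j => (hsm j).continuous
  set N := sobN 4 q with hN
  -- gradient bound
  have hgrad : ∀ i, ∀ x ∈ Metric.closedBall (0:Pt) 1, |pdX i q x| ≤ C1 * N := by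
    intro i x hx
    have := grad_bound hq3 i hx
    have e : C1 * N = Real.sqrt V * (21 * N) / V := by rw [hC1]; ring
    rw [e, le_div_iff₀ hVpos]
    linarith
  have hlip := lip_bound (hq3.of_le (by norm_num)) (C1 * N) hqz hgrad
  have hN0 : 0 ≤ N := Real.sqrt_nonneg _
  -- weighted Poincare inequality
  have hwp : nrm q ^ 2 ≤ 2 * C1 / c * N * ∫ x in disk, q x * φ 0 x := by
    rw [nrm_sq, ← integral_const_mul]
    apply setIntegral_mono_on (intOn (by fun_prop)) (intOn (by fun_prop))
      Metric.isOpen_ball.measurableSet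
    intro x hx
    have h1 := hlip x hx
    have h2 := hlow _ _ hgs x hx
    have h3 : 1 - ‖x‖ ≤ φ 0 x / c := by rw [le_div_iff₀ hc]; linarith
    have h4 : q x ≤ 2 * (C1 * N) * (φ 0 x / c) :=
      h1.trans (mul_le_mul_of_nonneg_left h3 (by positivity))
    have h5 := mul_le_mul_of_nonneg_left h4 (hqpos x hx).le
    calc q x ^ 2 = q x * q x := by ring
      _ ≤ _ := h5
      _ = _ := by ring
  have hnpos : 0 < nrm q := by
    apply Real.sqrt_pos.2
    rw [setIntegral_pos_iff_support_of_nonneg_ae]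
    · refine lt_of_lt_of_le (Metric.measure_ball_pos volume (0:Pt) one_pos) (measure_mono ?_)
      intro x hx
      exact ⟨by simpa using (hqpos x hx).ne', hx⟩
    · exact Filter.Eventually.of_forall fun x => sq_nonneg _
    · exact intOn (by fun_prop)
  rw [nrm_zero_eq, div_le_iff₀ hnpos] at hK
  have hcs := cauchy_schwarz hqc (hφc j)
  have hone : nrm (φ j) = 1 := by
    have := hort j j
    simp only [if_true] at this
    simp only [nrm, sq, this, Real.sqrt_one]
  rw [hone, mul_one] at hcs
  refine hcs.trans ?_
  have hint : 0 ≤ ∫ x in disk, q x * φ 0 x :=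
    setIntegral_nonneg Metric.isOpen_ball.measurableSet fun x hx =>
      (mul_pos (hqpos x hx) (hpos x hx)).le
  have h6 : nrm q * nrm q ≤ (2 * C1 / c * K * ∫ x in disk, q x * φ 0 x) * nrm q := by
    calc nrm q * nrm q = nrm q ^ 2 := by ring
      _ ≤ _ := hwp
      _ ≤ 2 * C1 / c * (K * nrm q) * ∫ x in disk, q x * φ 0 x := by gcongr
      _ = _ := by ring
  exact le_of_mul_le_mul_right h6 hnpos

end
end
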